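/- If k is a C_i field and l/k is a field extension of transcendence degree s, then l is C_{i+s} (Lang's transition theorem), in the special case i = 1, s = 1: if k is C_1 and l/k has transcendence degree 1, then l is C_2. -/

import Mathlib

/-- A field `K` is `C₁` if every homogeneous polynomial of degree `d ≥ 1` in `n + 1 > d`
variables has a nontrivial zero. -/
def IsC1Field (K : Type*) [Field K] : Prop :=
  ∀ (n d : ℕ) (f : MvPolynomial (Fin (n + 1)) K),
    f.IsHomogeneous d → 1 ≤ d → d ≤ n →
      ∃ x : Fin (n + 1) → K, x ≠ 0 ∧ MvPolynomial.eval x f = 0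

/-- A field `K` is `C₂` if every homogeneous polynomial of degree `d ≥ 1` in `n + 1 > d ^ 2`
variables has a nontrivial zero. -/
def IsC2Field (K : Type*) [Field K] : Prop :=
  ∀ (n d : ℕ) (f : MvPolynomial (Fin (n + 1)) K),
    f.IsHomogeneous d → 1 ≤ d → d ^ 2 ≤ n →
      ∃ x : Fin (n + 1) → K, x ≠ 0 ∧ MvPolynomial.eval x f = 0

open MvPolynomial in
/-- Over an algebraically closed field, fewer than `card σ` forms of positive degree have a common
nontrivial zero. -/
theorem exists_common_zero_algClosed {k : Type*} [Field k] [IsAlgClosed k]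
    {ι σ : Type*} [Fintype ι] [Fintype σ] (f : ι → MvPolynomial σ k) (d : ℕ) (hd : 1 ≤ d)
    (hf : ∀ i, (f i).IsHomogeneous d) (hcard : Fintype.card ι < Fintype.card σ) :
    ∃ x : σ → k, x ≠ 0 ∧ ∀ i, eval x (f i) = 0 := by
  classical
  by_contra! hcon
  have hdim : ringKrullDim (MvPolynomial σ k) ≤ ((Fintype.card ι : ℕ∞) : WithBot ℕ∞) := by
    rw [ringKrullDim_le_iff_isMaximal_height_le]
    intro M hM
    obtain ⟨a, ha⟩ := (isMaximal_iff_eq_vanishingIdeal_singleton (K := k)).1 hM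
    let g : ι → MvPolynomial σ k := fun i => aeval (fun j => X j - C (a j)) (f i)
    have hg : ∀ i x, aeval x (g i) = eval (fun j => x j - a j) (f i) := by
      intro i x
      simp only [g]
      rw [← AlgHom.comp_apply, comp_aeval]
      simp
    have hz : zeroLocus k (Ideal.span (Set.range g)) = {a} := by
      rw [zeroLocus_span]
      ext x
      simp only [Set.mem_range, forall_exists_index, forall_apply_eq_imp_iff, Set.mem_ofPred_eq,
        Set.mem_singleton_iff, hg]
      constructor
      · intro h
        by_contra hx
        obtain ⟨i, hi⟩ := hcon (fun j => x j - a j) (fun h0 => hx (by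
          funext j; have := congrFun h0 j; simpa [sub_eq_zero] using this))
        exact hi (h i)
      · rintro rfl i
        have : (fun j => x j - x j) = (0 : σ → k) := by ext; simp
        rw [this, eval_zero, constantCoeff_eq]
        exact (hf i).coeff_eq_zero (by simp; omega)
    have hrad : (Ideal.span (Set.range g)).radical = M := by
      rw [← vanishingIdeal_zeroLocus_eq_radical (K := k), hz, ha]
    have hmin : M ∈ (Ideal.span (Set.range g)).minimalPrimes := by
      refine ⟨⟨hM.isPrime, hrad ▸ Ideal.le_radical⟩, ?_⟩
      rintro p ⟨hp, hpl⟩ -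
      rw [← hrad]
      exact hp.radical_le_iff.2 hpl
    have h1 := Ideal.height_le_card_of_mem_minimalPrimes_span (Set.finite_range g) hmin
    have h2 : (Set.range g).ncard ≤ Fintype.card ι := by
      rw [← Nat.card_eq_fintype_card, ← Set.ncard_univ, ← Set.image_univ]
      exact Set.ncard_image_le
    exact_mod_cast h1.trans (by exact_mod_cast h2)
  have h3 := ringKrullDim_add_natCard_le_ringKrullDim_mvPolynomial (R := k) σ
  rw [ringKrullDim_eq_zero_of_field, zero_add, Nat.card_eq_fintype_card] at h3
  have h4 := h3.trans hdim
  have : Fintype.card σ ≤ Fintype.card ι := by exact_mod_cast h4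
  omega

open MvPolynomial in
/-- The `C₁` property for arbitrary finite index types. -/
theorem IsC1Field.exists_zero {k : Type*} [Field k] (hk : IsC1Field k) {σ : Type*} [Fintype σ]
    (f : MvPolynomial σ k) (d : ℕ) (hd : 1 ≤ d) (hf : f.IsHomogeneous d)
    (hcard : d < Fintype.card σ) : ∃ x : σ → k, x ≠ 0 ∧ eval x f = 0 := by
  obtain ⟨n, hn⟩ : ∃ n, Fintype.card σ = n + 1 := ⟨Fintype.card σ - 1, by omega⟩
  let e : σ ≃ Fin (n + 1) := Fintype.equivFinOfCardEq hn
  obtain ⟨x, hx, h0⟩ := hk n d (rename e f) hf.rename_isHomogeneous hd (by omega)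
  refine ⟨x ∘ e, fun h => hx ?_, by rwa [eval_rename] at h0⟩
  funext j
  have := congrFun h (e.symm j)
  simpa using this

/-- There is a normic form of degree `m`. -/
def HasNormic (k : Type*) [Field k] (m : ℕ) : Prop :=
  ∃ φ : MvPolynomial (Fin m) k, φ.IsHomogeneous m ∧
    ∀ x : Fin m → k, MvPolynomial.eval x φ = 0 → x = 0

open MvPolynomial in
theorem HasNormic.mul {k : Type*} [Field k] {a b : ℕ} (ha : HasNormic k a) (hb : HasNormic k b) :
    HasNormic k (a * b) := by
  obtain ⟨φ, hφ, hφ0⟩ := ha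
  obtain ⟨ψ, hψ, hψ0⟩ := hb
  refine ⟨aeval (fun i => rename (fun j => finProdFinEquiv (i, j)) ψ) φ, ?_, ?_⟩
  · have h := hφ.aeval (fun i => rename (fun j => finProdFinEquiv (i, j)) ψ)
      (fun i => hψ.rename_isHomogeneous)
    have hab : b * a = a * b := mul_comm b a
    convert h using 1
    exact hab.symm
  · intro x hx
    rw [← aeval_eq_eval, ← AlgHom.comp_apply, comp_aeval, aeval_eq_eval] at hx
    have h1 := hφ0 _ hx
    funext l
    obtain ⟨⟨i, j⟩, rfl⟩ := finProdFinEquiv.surjective l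
    have h2 := congrFun h1 i
    simp only [aeval_rename, Pi.zero_apply, aeval_eq_eval] at h2
    exact congrFun (hψ0 _ h2) j

open MvPolynomial in
theorem hasNormic_one (k : Type*) [Field k] : HasNormic k 1 := by
  refine ⟨X 0, isHomogeneous_X _ _, fun x hx => ?_⟩
  funext i
  rw [Subsingleton.elim i 0]
  simpa using hx

theorem HasNormic.pow {k : Type*} [Field k] {a : ℕ} (ha : HasNormic k a) (n : ℕ) :
    HasNormic k (a ^ n) := by
  induction n with
  | zero => simpa using hasNormic_one k
  | succ n ih => rw [pow_succ]; exact ih.mul ha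

theorem hasNormic_finrank (k K : Type*) [Field k] [Field K] [Algebra k K] [FiniteDimensional k K] :
    HasNormic k (Module.finrank k K) := by
  classical
  let b := Module.finBasis k K
  refine ⟨((Algebra.lmul k K).toLinearMap.polyCharpoly b).coeff 0,
    LinearMap.polyCharpoly_coeff_isHomogeneous _ _ _ _ (by simp), fun x hx => ?_⟩
  have h1 := LinearMap.polyCharpoly_coeff_eval (Algebra.lmul k K).toLinearMap b
    (b.equivFun.symm x) 0
  have h2 : (b.repr (b.equivFun.symm x) : Fin _ → k) = x := by
    rw [← Module.Basis.equivFun_apply, LinearEquiv.apply_symm_apply]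
  rw [h2, hx] at h1
  have h3 : LinearMap.det (Algebra.lmul k K (b.equivFun.symm x)) = 0 := by
    rw [LinearMap.det_eq_sign_charpoly_coeff]
    exact mul_eq_zero_of_right _ h1.symm
  have h4 : Algebra.norm k (b.equivFun.symm x) = 0 := h3
  rw [Algebra.norm_eq_zero_iff] at h4
  exact (LinearEquiv.map_eq_zero_iff _).1 h4

theorem exists_hasNormic {k : Type*} [Field k] (h : ¬ IsAlgClosed k) (N : ℕ) :
    ∃ m, N ≤ m ∧ 1 ≤ m ∧ HasNormic k m := by
  have : ∃ p : Polynomial k, Irreducible p ∧ p.natDegree ≠ 1 := by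
    by_contra! hcon
    exact h (IsAlgClosed.of_exists_root k fun p _ hp =>
      Polynomial.exists_root_of_degree_eq_one
        ((Polynomial.degree_eq_iff_natDegree_eq hp.ne_zero).2 (hcon p hp)))
  obtain ⟨p, hp, hp1⟩ := this
  have : Fact (Irreducible p) := ⟨hp⟩
  have hfin : Module.finrank k (AdjoinRoot p) = p.natDegree := by
    rw [(AdjoinRoot.powerBasis hp.ne_zero).finrank, AdjoinRoot.powerBasis_dim]
  have : FiniteDimensional k (AdjoinRoot p) := (AdjoinRoot.powerBasis hp.ne_zero).finite
  have hn := hasNormic_finrank k (AdjoinRoot p)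
  rw [hfin] at hn
  have hpos := hp.natDegree_pos
  refine ⟨p.natDegree ^ N, (Nat.lt_pow_self (by omega)).le, Nat.one_le_pow _ _ hpos, hn.pow N⟩

open MvPolynomial in
/-- Lang and Nagata for systems of forms over a `C₁` field. -/
theorem IsC1Field.exists_common_zero {k : Type*} [Field k] (hk : IsC1Field k)
    {ι σ : Type*} [Fintype ι] [Fintype σ] (f : ι → MvPolynomial σ k) (d : ℕ) (hd : 1 ≤ d)
    (hf : ∀ i, (f i).IsHomogeneous d) (hcard : Fintype.card ι * d < Fintype.card σ) :
    ∃ x : σ → k, x ≠ 0 ∧ ∀ i, eval x (f i) = 0 := by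
  classical
  by_cases hac : IsAlgClosed k
  · exact exists_common_zero_algClosed f d hd hf
      (lt_of_le_of_lt (Nat.le_mul_of_pos_right _ hd) hcard)
  rcases Nat.eq_zero_or_pos (Fintype.card ι) with hr | hr
  · have := Fintype.card_eq_zero_iff.1 hr
    have : Nonempty σ := Fintype.card_pos_iff.1 (by omega)
    exact ⟨1, one_ne_zero, fun i => isEmptyElim i⟩
  set r := Fintype.card ι with hrdef
  obtain ⟨e, he, he1, φ, hφ, hφ0⟩ := exists_hasNormic hac (r * (d * r + 1))
  set q := e / r with hq
  have hqr : q * r ≤ e := Nat.div_mul_le_self e r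
  have hemb : Nonempty (Fin q × ι ↪ Fin e) := by
    rw [Function.Embedding.nonempty_iff_card_le]
    simpa [← hrdef] using hqr
  obtain ⟨u⟩ := hemb
  let g : Fin q × ι → MvPolynomial (Fin q × σ) k := fun p => rename (fun s => (p.1, s)) (f p.2)
  let G : Fin e → MvPolynomial (Fin q × σ) k := Function.extend u g 0
  have hG : ∀ i, (G i).IsHomogeneous d := by
    intro i
    by_cases hi : ∃ p, u p = i
    · obtain ⟨p, rfl⟩ := hi
      simp only [G, u.injective.extend_apply, g]
      exact (hf _).rename_isHomogeneous
    · simp only [G, Function.extend_apply' _ _ _ hi]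
      exact isHomogeneous_zero _ _ _
  have hcard2 : d * e < Fintype.card (Fin q × σ) := by
    rw [Fintype.card_prod, Fintype.card_fin]
    have h1 : e % r < r := Nat.mod_lt _ hr
    have h2 : r * q + e % r = e := Nat.div_add_mod e r
    have h3 : d * r + 1 ≤ q := (Nat.le_div_iff_mul_le hr).2 (by rwa [mul_comm])
    have h4 : q * (r * d + 1) ≤ q * Fintype.card σ := Nat.mul_le_mul_left _ hcard
    have h5 : d * (e % r) ≤ d * r := Nat.mul_le_mul_left _ h1.le
    calc d * e = d * (r * q) + d * (e % r) := by rw [← mul_add, h2]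
      _ < d * (r * q) + q := by omega
      _ = q * (r * d + 1) := by ring
      _ ≤ _ := h4
  obtain ⟨x, hx, hx0⟩ := hk.exists_zero (aeval G φ) (d * e) (Nat.mul_pos hd he1) (hφ.aeval G hG)
    hcard2
  rw [← aeval_eq_eval, ← AlgHom.comp_apply, comp_aeval, aeval_eq_eval] at hx0
  have h1 := hφ0 _ hx0
  have h2 : ∀ b i, eval (fun s => x (b, s)) (f i) = 0 := by
    intro b i
    have h3 := congrFun h1 (u (b, i))
    simp only [G, u.injective.extend_apply, g, aeval_rename, aeval_eq_eval] at h3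
    exact h3
  obtain ⟨⟨b, s⟩, hbs⟩ := Function.ne_iff.1 hx
  exact ⟨fun s => x (b, s), Function.ne_iff.2 ⟨s, hbs⟩, h2 b⟩

open MvPolynomial in
/-- Apply a linear functional to the coefficients of a polynomial. -/
noncomputable def mapCoeffs {k A τ : Type*} [Field k] [CommRing A] [Algebra k A]
    (lam : A →ₗ[k] k) (P : MvPolynomial τ A) : MvPolynomial τ k :=
  ∑ m ∈ P.support, monomial m (lam (coeff m P))

open MvPolynomial in
theorem mapCoeffs_isHomogeneous {k A τ : Type*} [Field k] [CommRing A] [Algebra k A]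
    (lam : A →ₗ[k] k) {P : MvPolynomial τ A} {d : ℕ} (hP : P.IsHomogeneous d) :
    (mapCoeffs lam P).IsHomogeneous d := by
  refine IsHomogeneous.sum _ _ _ fun m hm => isHomogeneous_monomial _ ?_
  by_contra h
  exact (mem_support_iff.1 hm) (hP.coeff_eq_zero h)

open MvPolynomial in
theorem eval_mapCoeffs {k A τ : Type*} [Field k] [CommRing A] [Algebra k A]
    (lam : A →ₗ[k] k) (P : MvPolynomial τ A) (y : τ → k) :
    eval y (mapCoeffs lam P) = lam (eval (fun i => algebraMap k A (y i)) P) := by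
  rw [eval_eq (fun i => algebraMap k A (y i)), map_sum, mapCoeffs, map_sum]
  refine Finset.sum_congr rfl fun m _ => ?_
  rw [eval_monomial, ← smul_eq_mul, mul_comm (coeff m P)]
  simp only [← map_pow, ← map_prod]
  rw [← Algebra.smul_def, map_smul, smul_eq_mul, smul_eq_mul, mul_comm, Finsupp.prod]

open MvPolynomial in
theorem IsC1Field.exists_zero_of_subspace {k : Type*} [Field k] (hk : IsC1Field k)
    {A σ : Type*} [CommRing A] [Algebra k A] [Fintype σ] (f : MvPolynomial σ A) (d : ℕ)
    (hd : 1 ≤ d) (hf : f.IsHomogeneous d) (V W : Submodule k A) [FiniteDimensional k V]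
    [FiniteDimensional k W] (hmap : ∀ x : σ → A, (∀ i, x i ∈ V) → eval x f ∈ W)
    (hcard : Module.finrank k W * d < Module.finrank k V * Fintype.card σ) :
    ∃ x : σ → A, x ≠ 0 ∧ eval x f = 0 := by
  classical
  let bV := Module.finBasis k V
  let bW := Module.finBasis k W
  obtain ⟨π, hπ⟩ := LinearMap.exists_leftInverse_of_injective W.subtype (by simp)
  let F : MvPolynomial (σ × Fin (Module.finrank k V)) A :=
    aeval (fun s => ∑ j, C (bV j : A) * X (s, j)) f
  have hF : F.IsHomogeneous d := by
    have := hf.aeval (fun s => ∑ j, C (bV j : A) * X (s, j)) (n := 1)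
      (fun s => IsHomogeneous.sum _ _ _ fun j _ => (isHomogeneous_X A (s, j)).C_mul _)
    rwa [one_mul] at this
  obtain ⟨y, hy, hy0⟩ := hk.exists_common_zero
    (fun i => mapCoeffs (bW.coord i ∘ₗ π) F) d hd (fun i => mapCoeffs_isHomogeneous _ hF)
    (by simpa [mul_comm (Fintype.card σ)] using hcard)
  let z : σ → V := fun s => ∑ j, y (s, j) • bV j
  have hFe : eval (fun i => algebraMap k A (y i)) F = eval (fun s => (z s : A)) f := by
    simp only [F]
    rw [← aeval_eq_eval, ← AlgHom.comp_apply, comp_aeval, aeval_eq_eval]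
    congr 2
    funext s
    simp [z, Algebra.smul_def, mul_comm]
  refine ⟨fun s => z s, ?_, ?_⟩
  · intro h
    obtain ⟨⟨s, j⟩, hsj⟩ := Function.ne_iff.1 hy
    have h1 : z s = 0 := Subtype.ext (congrFun h s)
    exact hsj (Fintype.linearIndependent_iff.1 bV.linearIndependent (fun j => y (s, j)) h1 j)
  · have hmem := hmap (fun s => z s) (fun s => (z s).2)
    have hz : (⟨_, hmem⟩ : W) = 0 := by
      refine bW.ext_elem fun i => ?_
      have h1 := hy0 i
      rw [eval_mapCoeffs, hFe] at h1
      have h2 : π (eval (fun s => (z s : A)) f) = ⟨_, hmem⟩ := LinearMap.congr_fun hπ ⟨_, hmem⟩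
      simp only [LinearMap.comp_apply, h2, Module.Basis.coord_apply] at h1
      simpa using h1
    exact congrArg Subtype.val hz

open Polynomial in
theorem mul_mem_degreeLT_add {k : Type*} [Field k] {a b : ℕ} {p q : k[X]}
    (hp : p ∈ degreeLT k a) (hq : q ∈ degreeLT k b) : p * q ∈ degreeLT k (a + b) := by
  by_cases hp0 : p = 0
  · simp [hp0]
  by_cases hq0 : q = 0
  · simp [hq0]
  rw [mem_degreeLT, ← natDegree_lt_iff_degree_lt (by assumption)] at hp hq
  rw [mem_degreeLT, ← natDegree_lt_iff_degree_lt (mul_ne_zero hp0 hq0), natDegree_mul hp0 hq0]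
  omega

open Polynomial in
/-- Elements of a free `k[X]`-module whose coordinates have degree `< n`. -/
noncomputable def filt {k A ι : Type*} [Field k] [CommRing A] [Algebra k[X] A] [Algebra k A]
    [IsScalarTower k k[X] A] [Fintype ι] (b : Module.Basis ι k[X] A) (n : ℕ) : Submodule k A :=
  LinearMap.range ((b.equivFun.symm.restrictScalars k).toLinearMap ∘ₗ
    LinearMap.piMap (fun _ : ι => (degreeLT k n).subtype))

section filt

open Polynomial

variable {k A ι : Type*} [Field k] [CommRing A] [Algebra k[X] A] [Algebra k A]
    [IsScalarTower k k[X] A] [Fintype ι] (b : Module.Basis ι k[X] A)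

instance (n : ℕ) : FiniteDimensional k (degreeLT k n) :=
  Module.Finite.equiv (degreeLTEquiv k n).symm

instance (n : ℕ) : FiniteDimensional k (filt b n) := by
  unfold filt; infer_instance

theorem finrank_filt (n : ℕ) : Module.finrank k (filt b n) = Fintype.card ι * n := by
  rw [filt, LinearMap.finrank_range_of_inj, Module.finrank_pi_fintype,
    Finset.sum_congr rfl fun i _ => (degreeLTEquiv k n).finrank_eq]
  · simp
  · intro x y h
    have h1 := b.equivFun.symm.injective h
    funext i
    exact Subtype.ext (congrFun h1 i)

theorem mem_filt {n : ℕ} {x : A} : x ∈ filt b n ↔ ∀ i, b.repr x i ∈ degreeLT k n := by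
  constructor
  · rintro ⟨y, rfl⟩ i
    have : b.repr (b.equivFun.symm (fun i => (y i : k[X]))) i = y i := by
      rw [← Module.Basis.equivFun_apply, LinearEquiv.apply_symm_apply]
    exact this ▸ (y i).2
  · intro h
    refine ⟨fun i => ⟨b.repr x i, h i⟩, ?_⟩
    exact b.equivFun.symm_apply_apply x

theorem filt_mono {m n : ℕ} (h : m ≤ n) : filt b m ≤ filt b n := by
  intro x hx
  rw [mem_filt] at *
  exact fun i => degreeLT_mono h (hx i)

theorem exists_mem_filt (x : A) : ∃ n, x ∈ filt b n := by
  refine ⟨∑ i, ((b.repr x i).natDegree + 1), (mem_filt b).2 fun i => ?_⟩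
  have h1 : (b.repr x i).natDegree + 1 ≤ ∑ i, ((b.repr x i).natDegree + 1) :=
    Finset.single_le_sum (f := fun i => (b.repr x i).natDegree + 1)
      (fun _ _ => Nat.zero_le _) (Finset.mem_univ i)
  refine degreeLT_mono h1 ?_
  rw [mem_degreeLT]
  exact lt_of_le_of_lt degree_le_natDegree (by exact_mod_cast Nat.lt_succ_self _)

theorem exists_forall_mem_filt {κ : Type*} (s : Finset κ) (x : κ → A) :
    ∃ n, ∀ i ∈ s, x i ∈ filt b n := by
  choose n hn using fun i => exists_mem_filt b (x i)
  exact ⟨∑ i ∈ s, n i, fun i hi =>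
    filt_mono b (Finset.single_le_sum (fun _ _ => Nat.zero_le _) hi) (hn i)⟩

theorem smul_mem_filt {m n : ℕ} {p : k[X]} (hp : p ∈ degreeLT k m) {x : A} (hx : x ∈ filt b n) :
    p • x ∈ filt b (m + n) := by
  rw [mem_filt] at *
  intro i
  simpa using mul_mem_degreeLT_add hp (hx i)

theorem exists_filt_mul_le : ∃ c, ∀ m n, filt b m * filt b n ≤ filt b (m + n + c) := by
  obtain ⟨c, hc⟩ := exists_forall_mem_filt b Finset.univ (fun p : ι × ι => b p.1 * b p.2)
  refine ⟨c, fun m n => Submodule.mul_le.2 fun x hx y hy => ?_⟩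
  rw [mem_filt] at hx hy
  rw [← b.sum_repr x, ← b.sum_repr y, Finset.sum_mul]
  refine Submodule.sum_mem _ fun i _ => ?_
  rw [Finset.mul_sum]
  refine Submodule.sum_mem _ fun j _ => ?_
  rw [smul_mul_smul_comm]
  exact smul_mem_filt b (mul_mem_degreeLT_add (hx i) (hy j)) (hc (i, j) (Finset.mem_univ _))

end filt

theorem prod_pow_mem_pow {k A σ : Type*} [Field k] [CommRing A] [Algebra k A] (V : Submodule k A)
    (x : σ → A) (hx : ∀ i, x i ∈ V) (s : Finset σ) (m : σ → ℕ) :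
    ∏ i ∈ s, x i ^ m i ∈ V ^ (∑ i ∈ s, m i) := by
  classical
  induction s using Finset.induction_on with
  | empty => simp [Submodule.one_le.1 le_rfl]
  | insert a s ha ih =>
    rw [Finset.prod_insert ha, Finset.sum_insert ha, pow_add]
    exact Submodule.mul_mem_mul (Submodule.pow_mem_pow _ (hx a) _) ih

open Polynomial in
theorem IsC1Field.exists_zero_of_free {k : Type*} [Field k] (hk : IsC1Field k)
    {A σ : Type*} [CommRing A] [Nontrivial A] [Algebra k[X] A] [Algebra k A]
    [IsScalarTower k k[X] A] [Module.Free k[X] A] [Module.Finite k[X] A] [Fintype σ]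
    (f : MvPolynomial σ A) (d : ℕ)
    (hd : 1 ≤ d) (hf : f.IsHomogeneous d) (hcard : d ^ 2 < Fintype.card σ) :
    ∃ x : σ → A, x ≠ 0 ∧ MvPolynomial.eval x f = 0 := by
  classical
  let b := Module.Free.chooseBasis k[X] A
  obtain ⟨c, hc⟩ := exists_filt_mul_le (k := k) b
  obtain ⟨c0, hc0⟩ := exists_mem_filt (k := k) b (1 : A)
  obtain ⟨c1, hc1⟩ := exists_forall_mem_filt (k := k) b f.support (fun m => f.coeff m)
  have hpow : ∀ s n, filt b s ^ n ≤ filt b (c0 + n * (s + c)) := by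
    intro s n
    induction n with
    | zero => rw [pow_zero]; simpa [Submodule.one_le] using hc0
    | succ n ih =>
      rw [pow_succ]
      refine (mul_le_mul' ih le_rfl).trans ((hc _ _).trans (filt_mono b (le_of_eq (by ring))))
  set D := c1 + c0 + d * c + c with hD
  let s := D * d + 1
  have hι : 0 < Fintype.card (Module.Free.ChooseBasisIndex k[X] A) :=
    Fintype.card_pos_iff.2 b.index_nonempty
  refine hk.exists_zero_of_subspace f d hd hf (filt b s) (filt b (d * s + D)) ?_ ?_
  · intro x hx
    rw [MvPolynomial.eval_eq]
    refine Submodule.sum_mem _ fun m hm => ?_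
    have h1 := prod_pow_mem_pow _ x hx m.support m
    have h2 : ∑ i ∈ m.support, m i = d := by
      by_contra h
      exact (MvPolynomial.mem_support_iff.1 hm) (hf.coeff_eq_zero h)
    rw [h2] at h1
    refine filt_mono b (le_of_eq ?_) (hc _ _ (Submodule.mul_mem_mul (hc1 m hm) (hpow _ _ h1)))
    rw [hD]; ring
  · rw [finrank_filt, finrank_filt, mul_assoc, mul_assoc]
    refine Nat.mul_lt_mul_of_pos_left ?_ hι
    have h4 : s * (d ^ 2 + 1) ≤ s * Fintype.card σ := Nat.mul_le_mul_left _ hcard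
    refine lt_of_lt_of_le ?_ h4
    have : s * (d ^ 2 + 1) = (d * s + D) * d + 1 := by simp only [s]; ring
    omega

open scoped IntermediateField.algebraAdjoinAdjoin in
open Polynomial in
/-- Lang's transition theorem in the case `i = 1`, `s = 1`: if `k` is `C₁` and `l / k` is a
field extension of transcendence degree `1` (i.e. `l` is algebraic over `k(t)` for some
`t ∈ l` transcendental over `k`), then `l` is `C₂`. -/
theorem isC2Field_of_trdeg_one_over_C1 (k l : Type*) [Field k] [Field l] [Algebra k l]
    (hk : IsC1Field k)
    (t : l) (ht : Transcendental k t)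
    (halg : Algebra.IsAlgebraic (IntermediateField.adjoin k {t}) l) :
    IsC2Field l := by
  classical
  intro n d f hf hd hdn
  let : Algebra k[X] l := (aeval (R := k) t).toAlgebra
  have hmapeq : ∀ p : k[X], algebraMap k[X] l p = aeval t p := fun p => rfl
  have : IsScalarTower k k[X] l := IsScalarTower.of_algebraMap_eq fun x => by simp [hmapeq]
  have hinj : Function.Injective (algebraMap k[X] l) := transcendental_iff_injective.1 ht
  have : FaithfulSMul k[X] l := (faithfulSMul_iff_algebraMap_injective _ _).2 hinj
  have halg1 : Algebra.IsAlgebraic (Algebra.adjoin k {t}) l :=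
    (IsFractionRing.comap_isAlgebraic_iff (K := IntermediateField.adjoin k {t})).2 halg
  have halg2 : Algebra.IsAlgebraic k[X] l := by
    refine Algebra.IsAlgebraic.of_ringHom_of_comp_eq (S := Algebra.adjoin k {t}) (B := l)
      ((aeval (R := k) (⟨t, Algebra.self_mem_adjoin_singleton k t⟩ : Algebra.adjoin k {t})))
      (RingHom.id l) ?_ Function.injective_id ?_
    · rintro ⟨y, hy⟩
      rw [Algebra.adjoin_singleton_eq_range_aeval] at hy
      obtain ⟨p, rfl⟩ := hy
      exact ⟨p, Subtype.ext (by simp)⟩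
    · ext <;> simp [hmapeq]
  obtain ⟨y, hy0, hy⟩ := Algebra.IsAlgebraic.exists_integral_multiples (R := k[X]) f.coeffs
  have hy1 : algebraMap k[X] l y ≠ 0 := fun h => hy0 (hinj (by simpa using h))
  let S : Finset l := f.coeffs.image (fun z => y • z)
  let A := Algebra.adjoin k[X] (S : Set l)
  have : Module.Finite k[X] A := Module.Finite.iff_fg.2 (fg_adjoin_of_finite S.finite_toSet (by
    intro x hx
    obtain ⟨z, hz, rfl⟩ := Finset.mem_image.1 hx
    exact hy z hz))
  obtain ⟨g, hg⟩ : ∃ g : MvPolynomial (Fin (n + 1)) A,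
      MvPolynomial.map (algebraMap A l) g = MvPolynomial.C (algebraMap k[X] l y) * f := by
    have := (MvPolynomial.mem_range_map_iff_coeffs_subset (f := algebraMap A l)
      (x := MvPolynomial.C (algebraMap k[X] l y) * f)).2 (by
        intro z hz
        obtain ⟨m, hm, rfl⟩ := MvPolynomial.mem_coeffs_iff.1 hz
        rw [MvPolynomial.mem_support_iff, MvPolynomial.coeff_C_mul] at hm
        refine ⟨⟨_, Algebra.subset_adjoin (Finset.mem_image.2
          ⟨f.coeff m, MvPolynomial.coeff_mem_coeffs m (right_ne_zero_of_mul hm), rfl⟩)⟩, ?_⟩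
        rw [MvPolynomial.coeff_C_mul, ← Algebra.smul_def]
        rfl)
    exact this
  have hAinj : Function.Injective (algebraMap A l) := Subtype.val_injective
  have hgh : g.IsHomogeneous d := by
    refine MvPolynomial.IsHomogeneous.of_map hAinj ?_
    rw [hg]
    exact hf.C_mul _
  obtain ⟨x, hx, hx0⟩ := hk.exists_zero_of_free g d hd hgh (by simpa using Nat.lt_succ_of_le hdn)
  refine ⟨fun i => algebraMap A l (x i), ?_, ?_⟩
  · intro h
    exact hx (funext fun i => hAinj (by simpa using congrFun h i))
  · have h1 := congrArg (algebraMap A l) hx0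
    rw [map_zero, MvPolynomial.eval, MvPolynomial.coe_eval₂Hom] at h1
    have h2 : MvPolynomial.eval (fun i => algebraMap A l (x i))
        (MvPolynomial.map (algebraMap A l) g) = 0 := by
      rw [MvPolynomial.eval_map, ← h1, MvPolynomial.eval₂_comp_left]
      rfl
    rw [hg, map_mul, MvPolynomial.eval_C] at h2
    exact (mul_eq_zero.1 h2).resolve_left hy1
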